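/- Let 𝒯 be a finite undirected tree, w : V(𝒯) → ℝ≥0 a weight function, m = w(𝒯), and let C be a centroid tree of (𝒯,w) with cost_w(C) = cent(𝒯,w). Let P = (v_0, v_1, …, v_p) be a downward path in C starting at the root (i.e., v_0 is the root of C and each v_{i+1} is a child of v_i in C). Then cent(𝒯,w) ≤ (2 − 1/2^p)·m + Σ_{ℋ ∈ 𝒞(𝒯−P)} cent(ℋ,w), where the sum ranges over the connected components of the forest obtained from 𝒯 by deleting the vertices v_0, …, v_p. -/

import Mathlib

open Filter Topology

universe u

variable {V : Type u}

/-- Rooted trees with vertices labelled by elements of `V`. -/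
inductive RTree (V : Type u) : Type u where
  | node : V → List (RTree V) → RTree V

namespace RTree

/-- The root of a rooted tree. -/
def root : RTree V → V
  | node r _ => r

/-- The subtrees rooted at the children of the root. -/
def children : RTree V → List (RTree V)
  | node _ ts => ts

/-- The list of pairs `(v, path from the root to v)` over all vertices `v` of the tree. -/
def pathsFrom : RTree V → List (V × List V)
  | node r ts =>
      (r, [r]) ::
        (ts.attach.map fun t => (t.1.pathsFrom.map fun p => (p.1, r :: p.2))).flatten
  decreasing_by
    simp only [RTree.node.sizeOf_spec]
    have := List.sizeOf_lt_of_mem t.2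
    omega

/-- The vertex set of a rooted tree. -/
def vertSet (T : RTree V) : Set V := {v | ∃ p ∈ T.pathsFrom, p.1 = v}

/-- `Path_T(v)`: the set of vertices on the path in `T` from the root to `v`
(including both endpoints). -/
def pathSet (T : RTree V) (v : V) : Set V := {x | ∃ p ∈ T.pathsFrom, p.1 = v ∧ x ∈ p.2}

/-- The depth of a vertex `v` in `T`; the root has depth 1. -/
noncomputable def depth (T : RTree V) (v : V) : ℕ := (T.pathSet v).ncard

/-- All subtrees of a rooted tree (including the tree itself). -/
def allSubtrees : RTree V → List (RTree V)
  | node r ts => node r ts :: (ts.attach.map fun t => t.1.allSubtrees).flatten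
  decreasing_by
    simp only [RTree.node.sizeOf_spec]
    have := List.sizeOf_lt_of_mem t.2
    omega

/-- Two rooted trees are equivalent (represent the same search tree) if they have
the same root-to-vertex paths. -/
def Equiv (T₁ T₂ : RTree V) : Prop := ∀ v, T₁.pathSet v = T₂.pathSet v

end RTree

/-- `x` and `y` are joined by a walk of `G` staying inside `s`. -/
def ReachIn (G : SimpleGraph V) (s : Set V) (x y : V) : Prop :=
  ∃ p : G.Walk x y, ∀ v ∈ p.support, v ∈ s

/-- The connected component of `x` in the subgraph of `G` induced by `s`. -/
def compIn (G : SimpleGraph V) (s : Set V) (x : V) : Set V := {y | ReachIn G s x y}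

/-- The set of connected components of the subgraph of `G` induced by `s`. -/
def comps (G : SimpleGraph V) (s : Set V) : Set (Set V) := {c | ∃ x ∈ s, c = compIn G s x}

/-- `s` induces a (nonempty) connected subgraph of `G`. -/
def ConnIn (G : SimpleGraph V) (s : Set V) : Prop :=
  s.Nonempty ∧ ∀ x ∈ s, ∀ y ∈ s, ReachIn G s x y

/-- The total weight of a set of vertices. -/
noncomputable def wsum (w : V → ℝ) (s : Set V) : ℝ := ∑ᶠ x ∈ s, w x

/-- `IsSearchTree G s T`: `T` is a search tree on the subgraph of `G` induced by `s`.
Its root `r` is a vertex of `s`, its vertex set is `s`, and the subtrees rooted at the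
children of `r` are search trees on the connected components of the induced subgraph
on `s \ {r}` (one subtree for each component). -/
inductive IsSearchTree (G : SimpleGraph V) : Set V → RTree V → Prop where
  | node {s : Set V} {r : V} {ts : List (RTree V)} :
      r ∈ s →
      (RTree.node r ts).vertSet = s →
      (∀ t ∈ ts, IsSearchTree G (compIn G (s \ {r}) t.root) t) →
      ts.Pairwise (fun t₁ t₂ => compIn G (s \ {r}) t₁.root ≠ compIn G (s \ {r}) t₂.root) →
      IsSearchTree G s (RTree.node r ts)

/-- The cost of a search tree: `∑_x w(x) · depth(x)`, the root having depth 1. -/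
noncomputable def cost (w : V → ℝ) (T : RTree V) : ℝ :=
  ∑ᶠ v ∈ T.vertSet, w v * (T.depth v : ℝ)

/-- The optimum cost of a search tree on the subgraph of `G` induced by `s`. -/
noncomputable def OPT (G : SimpleGraph V) (w : V → ℝ) (s : Set V) : ℝ :=
  sInf (cost w '' {T | IsSearchTree G s T})

/-- `v` is an `α`-centroid of the subgraph of `G` induced by `s` (with weights `w`):
every connected component of the induced subgraph on `s \ {v}` has weight at most
`α` times the weight of `s`. -/
def IsAlphaCentroid (G : SimpleGraph V) (w : V → ℝ) (α : ℝ) (s : Set V) (v : V) : Prop :=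
  v ∈ s ∧ ∀ x ∈ s \ {v}, wsum w (compIn G (s \ {v}) x) ≤ α * wsum w s

/-- `v` is a centroid of the subgraph of `G` induced by `s` (with weights `w`). -/
def IsCentroid (G : SimpleGraph V) (w : V → ℝ) (s : Set V) (v : V) : Prop :=
  v ∈ s ∧ ∀ x ∈ s \ {v}, wsum w (compIn G (s \ {v}) x) ≤ wsum w s / 2

/-- `T` is an `α`-centroid tree on the subgraph of `G` induced by `s`. -/
def IsAlphaCentroidTree (G : SimpleGraph V) (w : V → ℝ) (α : ℝ) (s : Set V) (T : RTree V) :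
    Prop :=
  IsSearchTree G s T ∧ ∀ t ∈ T.allSubtrees, IsAlphaCentroid G w α t.vertSet t.root

/-- `T` is a centroid tree on the subgraph of `G` induced by `s`. -/
def IsCentroidTree (G : SimpleGraph V) (w : V → ℝ) (s : Set V) (T : RTree V) : Prop :=
  IsSearchTree G s T ∧ ∀ t ∈ T.allSubtrees, IsCentroid G w t.vertSet t.root

/-- `cent(𝒯,w)`: the maximum cost of a centroid tree. -/
noncomputable def centCost (G : SimpleGraph V) (w : V → ℝ) (s : Set V) : ℝ :=
  sSup (cost w '' {T | IsCentroidTree G w s T})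

/-- `centᵅ(𝒯,w)`: the maximum cost of an `α`-centroid tree (`0` if none exists, since
`sSup ∅ = 0` in `ℝ`). -/
noncomputable def centCostA (G : SimpleGraph V) (w : V → ℝ) (α : ℝ) (s : Set V) : ℝ :=
  sSup (cost w '' {T | IsAlphaCentroidTree G w α s T})

/-- `b` is a child of `a` in the rooted tree `T`. -/
def ChildRel (T : RTree V) (a b : V) : Prop :=
  ∃ t ∈ T.allSubtrees, t.root = a ∧ ∃ t' ∈ t.children, t'.root = b

namespace RTree

theorem mem_pathsFrom_node {r : V} {ts : List (RTree V)} {q : V × List V} :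
    q ∈ (node r ts).pathsFrom ↔
      q = (r, [r]) ∨ ∃ t ∈ ts, ∃ p ∈ t.pathsFrom, q = (p.1, r :: p.2) := by
  rw [pathsFrom]
  simp only [List.mem_cons, List.mem_flatten, List.mem_map, List.mem_attach, true_and,
    Subtype.exists]
  constructor
  · rintro (h | ⟨l, ⟨t, ht, rfl⟩, hq⟩)
    · exact Or.inl h
    · obtain ⟨p, hp, rfl⟩ := List.mem_map.1 hq
      exact Or.inr ⟨t, ht, p, hp, rfl⟩
  · rintro (h | ⟨t, ht, p, hp, rfl⟩)
    · exact Or.inl h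
    · exact Or.inr ⟨_, ⟨t, ht, rfl⟩, List.mem_map.2 ⟨p, hp, rfl⟩⟩

theorem mem_allSubtrees_node {r : V} {ts : List (RTree V)} {q : RTree V} :
    q ∈ (node r ts).allSubtrees ↔ q = node r ts ∨ ∃ t ∈ ts, q ∈ t.allSubtrees := by
  rw [allSubtrees]
  simp only [List.mem_cons, List.mem_flatten, List.mem_map, List.mem_attach, true_and,
    Subtype.exists]
  constructor
  · rintro (h | ⟨l, ⟨t, ht, rfl⟩, hq⟩)
    · exact Or.inl h
    · exact Or.inr ⟨t, ht, hq⟩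
  · rintro (h | ⟨t, ht, hq⟩)
    · exact Or.inl h
    · exact Or.inr ⟨_, ⟨t, ht, rfl⟩, hq⟩

theorem vertSet_node (r : V) (ts : List (RTree V)) :
    (node r ts).vertSet = {r} ∪ ⋃ t ∈ {t | t ∈ ts}, t.vertSet := by
  ext v
  simp only [vertSet, Set.mem_ofPred_eq, mem_pathsFrom_node, Set.mem_union, Set.mem_singleton_iff,
    Set.mem_iUnion]
  constructor
  · rintro ⟨_, rfl | ⟨t, ht, p, hp, rfl⟩, rfl⟩
    · exact Or.inl rfl
    · exact Or.inr ⟨t, ht, p, hp, rfl⟩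
  · rintro (rfl | ⟨t, ht, p, hp, rfl⟩)
    · exact ⟨_, Or.inl rfl, rfl⟩
    · exact ⟨_, Or.inr ⟨t, ht, p, hp, rfl⟩, rfl⟩

theorem self_mem_allSubtrees (T : RTree V) : T ∈ T.allSubtrees := by
  cases T
  exact mem_allSubtrees_node.2 (Or.inl rfl)

theorem mem_allSubtrees_of_mem_children {r : V} {ts : List (RTree V)} {t : RTree V}
    (ht : t ∈ ts) : t ∈ (node r ts).allSubtrees :=
  mem_allSubtrees_node.2 (Or.inr ⟨t, ht, t.self_mem_allSubtrees⟩)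

theorem root_mem_vertSet (T : RTree V) : T.root ∈ T.vertSet := by
  cases T
  rw [vertSet_node]
  exact Or.inl rfl

theorem vertSet_subset_of_mem_children {r : V} {ts : List (RTree V)} {t : RTree V}
    (ht : t ∈ ts) : t.vertSet ⊆ (node r ts).vertSet := by
  rw [vertSet_node]
  exact fun x hx => Or.inr (Set.mem_biUnion (show t ∈ {t | t ∈ ts} from ht) hx)

theorem vertSet_subset_of_mem_allSubtrees {q : RTree V} :
    (T : RTree V) → q ∈ T.allSubtrees → q.vertSet ⊆ T.vertSet
  | node r ts => fun h => by
    rcases mem_allSubtrees_node.1 h with rfl | ⟨t, ht, hq⟩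
    · exact subset_rfl
    · have := List.sizeOf_lt_of_mem ht
      exact (vertSet_subset_of_mem_allSubtrees t hq).trans (vertSet_subset_of_mem_children ht)
  termination_by T => sizeOf T
  decreasing_by
    simp only [RTree.node.sizeOf_spec]
    omega

theorem path_subset_vertSet {q : V × List V} :
    (T : RTree V) → q ∈ T.pathsFrom → ∀ x ∈ q.2, x ∈ T.vertSet
  | node r ts => fun h x hx => by
    rcases mem_pathsFrom_node.1 h with rfl | ⟨t, ht, p, hp, rfl⟩
    · rw [List.mem_singleton.1 hx]
      exact root_mem_vertSet (node r ts)
    · rcases List.mem_cons.1 hx with rfl | hx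
      · exact root_mem_vertSet (node x ts)
      · have := List.sizeOf_lt_of_mem ht
        exact vertSet_subset_of_mem_children ht (path_subset_vertSet t hp x hx)
  termination_by T => sizeOf T
  decreasing_by
    simp only [RTree.node.sizeOf_spec]
    omega

theorem pathSet_subset_vertSet (T : RTree V) (v : V) : T.pathSet v ⊆ T.vertSet := by
  rintro x ⟨p, hp, -, hx⟩
  exact path_subset_vertSet T hp x hx

end RTree

open RTree

theorem ReachIn.trans {G : SimpleGraph V} {s : Set V} {x y z : V}
    (h₁ : ReachIn G s x y) (h₂ : ReachIn G s y z) : ReachIn G s x z := by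
  obtain ⟨p, hp⟩ := h₁
  obtain ⟨q, hq⟩ := h₂
  refine ⟨p.append q, fun v hv => ?_⟩
  rcases (SimpleGraph.Walk.mem_support_append_iff p q).1 hv with h | h
  exacts [hp v h, hq v h]

theorem ReachIn.symm {G : SimpleGraph V} {s : Set V} {x y : V}
    (h : ReachIn G s x y) : ReachIn G s y x := by
  obtain ⟨p, hp⟩ := h
  exact ⟨p.reverse, fun v hv => hp v (by simpa using hv)⟩

theorem ReachIn.mono {G : SimpleGraph V} {s t : Set V} {x y : V} (hst : s ⊆ t)
    (h : ReachIn G s x y) : ReachIn G t x y := by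
  obtain ⟨p, hp⟩ := h
  exact ⟨p, fun v hv => hst (hp v hv)⟩

theorem mem_compIn_self {G : SimpleGraph V} {s : Set V} {x : V} (hx : x ∈ s) :
    x ∈ compIn G s x :=
  ⟨SimpleGraph.Walk.nil, by simpa using hx⟩

theorem compIn_subset {G : SimpleGraph V} {s : Set V} {x : V} : compIn G s x ⊆ s := by
  rintro y ⟨p, hp⟩
  exact hp y p.end_mem_support

theorem compIn_eq_of_mem {G : SimpleGraph V} {s : Set V} {x y : V} (hy : y ∈ compIn G s x) :
    compIn G s y = compIn G s x :=
  Set.ext fun _ => ⟨fun h => ReachIn.trans hy h, fun h => ReachIn.trans (ReachIn.symm hy) h⟩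

theorem compIn_disjoint {G : SimpleGraph V} {s : Set V} {x y : V}
    (h : compIn G s x ≠ compIn G s y) : Disjoint (compIn G s x) (compIn G s y) :=
  Set.disjoint_left.2 fun _ hx hy => h ((compIn_eq_of_mem hx).symm.trans (compIn_eq_of_mem hy))

theorem compIn_eq_compIn_inter {G : SimpleGraph V} {A B : Set V} {x y : V} (hBA : B ⊆ A)
    (hy : y ∈ compIn G A x) : compIn G B y = compIn G (compIn G A x ∩ B) y := by
  classical
  refine Set.ext fun z => ⟨?_, fun h => ReachIn.mono Set.inter_subset_right h⟩
  rintro ⟨p, hp⟩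
  refine ⟨p, fun u hu => ⟨ReachIn.trans hy ⟨p.takeUntil u hu, fun v hv => ?_⟩, hp u hu⟩⟩
  exact hBA (hp v (p.support_takeUntil_subset_support hu hv))

theorem IsSearchTree.vertSet_eq {G : SimpleGraph V} {s : Set V} {T : RTree V}
    (h : IsSearchTree G s T) : T.vertSet = s := by
  cases h
  assumption

section Children

variable {G : SimpleGraph V} {s : Set V} {r : V} {ts : List (RTree V)}

theorem IsSearchTree.child (h : IsSearchTree G s (RTree.node r ts)) {t : RTree V} (ht : t ∈ ts) :
    IsSearchTree G (compIn G (s \ {r}) t.root) t := by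
  cases h with
  | node _ _ hc _ => exact hc t ht

theorem IsSearchTree.child_vertSet (h : IsSearchTree G s (RTree.node r ts)) {t : RTree V}
    (ht : t ∈ ts) : t.vertSet = compIn G (s \ {r}) t.root :=
  (h.child ht).vertSet_eq

theorem IsSearchTree.child_vertSet_subset (h : IsSearchTree G s (RTree.node r ts)) {t : RTree V}
    (ht : t ∈ ts) : t.vertSet ⊆ s \ {r} := by
  rw [h.child_vertSet ht]
  exact compIn_subset

theorem IsSearchTree.root_notMem_child (h : IsSearchTree G s (RTree.node r ts)) {t : RTree V}
    (ht : t ∈ ts) : r ∉ t.vertSet :=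
  fun hr => (h.child_vertSet_subset ht hr).2 rfl

theorem IsSearchTree.disjoint_children (h : IsSearchTree G s (RTree.node r ts)) :
    {t | t ∈ ts}.PairwiseDisjoint RTree.vertSet := by
  intro a ha b hb hab
  have hne : compIn G (s \ {r}) a.root ≠ compIn G (s \ {r}) b.root := by
    cases h with
    | node _ _ _ hp =>
      have : Std.Symm fun t₁ t₂ : RTree V =>
          compIn G (s \ {r}) t₁.root ≠ compIn G (s \ {r}) t₂.root := ⟨fun _ _ h => h.symm⟩
      exact hp.forall ha hb hab
  change Disjoint a.vertSet b.vertSet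
  rw [h.child_vertSet ha, h.child_vertSet hb]
  exact compIn_disjoint hne

theorem IsSearchTree.eq_of_mem_children (h : IsSearchTree G s (RTree.node r ts)) {a b : RTree V}
    (ha : a ∈ ts) (hb : b ∈ ts) {x : V} (hxa : x ∈ a.vertSet) (hxb : x ∈ b.vertSet) : a = b := by
  by_contra hab
  exact Set.disjoint_left.1 (h.disjoint_children ha hb hab) hxa hxb

theorem IsSearchTree.finsum_eq [Finite V] (h : IsSearchTree G s (RTree.node r ts)) (f : V → ℝ) :
    ∑ᶠ x ∈ (RTree.node r ts).vertSet, f x = f r + ∑ᶠ t ∈ {t | t ∈ ts}, ∑ᶠ x ∈ t.vertSet, f x := by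
  rw [vertSet_node, finsum_mem_union _ (Set.toFinite _) (Set.toFinite _), finsum_mem_singleton,
    finsum_mem_biUnion h.disjoint_children ts.finite_toSet fun _ _ => Set.toFinite _]
  rw [Set.disjoint_singleton_left, Set.mem_iUnion₂]
  rintro ⟨t, ht, hr⟩
  exact h.root_notMem_child ht hr

theorem IsSearchTree.depth_root (h : IsSearchTree G s (RTree.node r ts)) :
    (RTree.node r ts).depth r = 1 := by
  have : (RTree.node r ts).pathSet r = {r} := by
    ext x
    constructor
    · rintro ⟨p, hp, hpr, hx⟩
      rcases mem_pathsFrom_node.1 hp with rfl | ⟨t, ht, q, hq, rfl⟩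
      · simpa using hx
      · exact (h.root_notMem_child ht ⟨q, hq, hpr⟩).elim
    · rintro rfl
      exact ⟨_, mem_pathsFrom_node.2 (Or.inl rfl), rfl, by simp⟩
  rw [RTree.depth, this, Set.ncard_singleton]

theorem IsSearchTree.depth_child [Finite V] (h : IsSearchTree G s (RTree.node r ts)) {t : RTree V}
    (ht : t ∈ ts) {x : V} (hx : x ∈ t.vertSet) : (RTree.node r ts).depth x = t.depth x + 1 := by
  have : (RTree.node r ts).pathSet x = insert r (t.pathSet x) := by
    ext y
    constructor
    · rintro ⟨p, hp, hpx, hy⟩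
      rcases mem_pathsFrom_node.1 hp with rfl | ⟨t', ht', q, hq, rfl⟩
      · exact Or.inl (by simpa using hy)
      · obtain rfl := h.eq_of_mem_children ht ht' hx ⟨q, hq, hpx⟩
        rcases List.mem_cons.1 hy with rfl | hy
        · exact Or.inl rfl
        · exact Or.inr ⟨q, hq, hpx, hy⟩
    · rintro (rfl | ⟨q, hq, hqx, hy⟩)
      · obtain ⟨q, hq, hqx⟩ := hx
        exact ⟨_, mem_pathsFrom_node.2 (Or.inr ⟨t, ht, q, hq, rfl⟩), hqx, by simp⟩
      · exact ⟨_, mem_pathsFrom_node.2 (Or.inr ⟨t, ht, q, hq, rfl⟩), hqx,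
          List.mem_cons_of_mem _ hy⟩
  rw [RTree.depth, this, Set.ncard_insert_of_notMem _ (Set.toFinite _), RTree.depth]
  exact fun hr => h.root_notMem_child ht (t.pathSet_subset_vertSet x hr)

theorem IsSearchTree.cost_eq [Finite V] (h : IsSearchTree G s (RTree.node r ts)) (w : V → ℝ) :
    cost w (RTree.node r ts) = wsum w s + ∑ᶠ t ∈ {t | t ∈ ts}, cost w t := by
  have hsum : wsum w s = w r + ∑ᶠ t ∈ {t | t ∈ ts}, ∑ᶠ x ∈ t.vertSet, w x := by
    rw [← h.finsum_eq, h.vertSet_eq, wsum]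
  rw [cost, h.finsum_eq, hsum, h.depth_root, add_assoc,
    ← finsum_mem_add_distrib ts.finite_toSet]
  congr 1
  · simp
  · refine finsum_mem_congr rfl fun t ht => ?_
    rw [cost, ← finsum_mem_add_distrib (Set.toFinite _)]
    refine finsum_mem_congr rfl fun x hx => ?_
    rw [h.depth_child ht hx]
    push_cast
    ring

theorem IsCentroidTree.child {w : V → ℝ} (h : IsCentroidTree G w s (RTree.node r ts)) {t : RTree V}
    (ht : t ∈ ts) : IsCentroidTree G w t.vertSet t := by
  refine ⟨?_, fun q hq => h.2 q (mem_allSubtrees_node.2 (Or.inr ⟨t, ht, hq⟩))⟩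
  rw [h.1.child_vertSet ht]
  exact h.1.child ht

theorem IsCentroidTree.wsum_child_le {w : V → ℝ} (h : IsCentroidTree G w s (RTree.node r ts))
    {t : RTree V} (ht : t ∈ ts) : wsum w t.vertSet ≤ wsum w s / 2 := by
  have hc := h.2 _ (self_mem_allSubtrees _)
  rw [h.1.vertSet_eq] at hc
  rw [h.1.child_vertSet ht]
  exact hc.2 _ (h.1.child_vertSet_subset ht t.root_mem_vertSet)

/-- A child of the root of a search tree survives, as a connected component, the deletion of the
root together with any set of vertices that it does not meet. -/
theorem IsSearchTree.child_vertSet_mem_comps (h : IsSearchTree G s (RTree.node r ts)) {t : RTree V}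
    (ht : t ∈ ts) {B : Set V} (hB : B ⊆ s \ {r}) (htB : t.vertSet ⊆ B) :
    t.vertSet ∈ comps G B := by
  have hroot := t.root_mem_vertSet
  refine ⟨t.root, htB hroot, ?_⟩
  have hmem : t.root ∈ compIn G (s \ {r}) t.root := h.child_vertSet ht ▸ hroot
  rw [compIn_eq_compIn_inter hB hmem, ← h.child_vertSet ht, Set.inter_eq_left.2 htB]
  conv_lhs => rw [h.child_vertSet ht, compIn_eq_compIn_inter subset_rfl hmem,
    Set.inter_eq_left.2 compIn_subset, ← h.child_vertSet ht]

/-- The path leaving the root through the child `t` is a downward path of `t`. -/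
theorem IsSearchTree.childRel_child (h : IsSearchTree G s (RTree.node r ts)) {t : RTree V} (ht : t ∈ ts)
    {a b : V} (ha : a ∈ t.vertSet) (hab : ChildRel (RTree.node r ts) a b) : ChildRel t a b := by
  obtain ⟨q, hq, rfl, hb⟩ := hab
  rcases mem_allSubtrees_node.1 hq with rfl | ⟨t', ht', hq'⟩
  · exact (h.root_notMem_child ht ha).elim
  · obtain rfl := h.eq_of_mem_children ht ht' ha
      (vertSet_subset_of_mem_allSubtrees t' hq' q.root_mem_vertSet)
    exact ⟨q, hq', rfl, hb⟩

theorem IsSearchTree.exists_child_of_childRel (h : IsSearchTree G s (RTree.node r ts)) {b : V}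
    (hb : ChildRel (RTree.node r ts) r b) : ∃ t ∈ ts, t.root = b := by
  obtain ⟨q, hq, hqr, hb⟩ := hb
  rcases mem_allSubtrees_node.1 hq with rfl | ⟨t, ht, hq'⟩
  · exact hb
  · exact (h.root_notMem_child ht
      (hqr ▸ vertSet_subset_of_mem_allSubtrees t hq' q.root_mem_vertSet)).elim

end Children

theorem ChildRel.mem_vertSet {T : RTree V} {a b : V} (h : ChildRel T a b) : b ∈ T.vertSet := by
  obtain ⟨⟨r, ts⟩, hq, -, t, ht, rfl⟩ := h
  exact vertSet_subset_of_mem_allSubtrees T hq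
    (vertSet_subset_of_mem_children ht t.root_mem_vertSet)

theorem finsum_mem_nonneg {ι : Type*} {f : ι → ℝ} {s : Set ι} (hf : ∀ i ∈ s, 0 ≤ f i) :
    0 ≤ ∑ᶠ i ∈ s, f i :=
  finsum_nonneg fun i => finsum_nonneg (hf i)

theorem finsum_mem_le_finsum_mem {ι : Type*} {f g : ι → ℝ} {s : Set ι} (hs : s.Finite)
    (h : ∀ i ∈ s, f i ≤ g i) : ∑ᶠ i ∈ s, f i ≤ ∑ᶠ i ∈ s, g i := by
  rw [finsum_mem_eq_finite_toFinset_sum _ hs, finsum_mem_eq_finite_toFinset_sum _ hs]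
  exact Finset.sum_le_sum fun i hi => h i (hs.mem_toFinset.1 hi)

theorem finsum_mem_le_of_subset {ι : Type*} {f : ι → ℝ} {s t : Set ι} (hst : s ⊆ t)
    (ht : t.Finite) (hf : ∀ i, 0 ≤ f i) : ∑ᶠ i ∈ s, f i ≤ ∑ᶠ i ∈ t, f i := by
  rw [← finsum_mem_inter_add_sdiff s ht, Set.inter_eq_right.2 hst]
  exact le_add_of_nonneg_right (finsum_mem_nonneg fun i _ => hf i)

theorem cost_nonneg {w : V → ℝ} (hw : ∀ x, 0 ≤ w x) (T : RTree V) : 0 ≤ cost w T :=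
  finsum_mem_nonneg fun x _ => mul_nonneg (hw x) (Nat.cast_nonneg _)

theorem centCost_nonneg (G : SimpleGraph V) {w : V → ℝ} (hw : ∀ x, 0 ≤ w x) (s : Set V) :
    0 ≤ centCost G w s := by
  refine Real.sSup_nonneg ?_
  rintro _ ⟨T, -, rfl⟩
  exact cost_nonneg hw T

theorem cost_le [Finite V] {w : V → ℝ} (hw : ∀ x, 0 ≤ w x) (T : RTree V) :
    cost w T ≤ ∑ᶠ x ∈ T.vertSet, w x * (Nat.card V : ℝ) := by
  refine finsum_mem_le_finsum_mem (Set.toFinite _) fun x _ => ?_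
  refine mul_le_mul_of_nonneg_left ?_ (hw x)
  exact_mod_cast Set.ncard_le_card _

theorem IsCentroidTree.cost_le_centCost [Finite V] {G : SimpleGraph V} {w : V → ℝ}
    (hw : ∀ x, 0 ≤ w x) {s : Set V} {T : RTree V} (h : IsCentroidTree G w s T) :
    cost w T ≤ centCost G w s := by
  refine le_csSup ⟨∑ᶠ x ∈ s, w x * (Nat.card V : ℝ), ?_⟩ ⟨T, h, rfl⟩
  rintro _ ⟨T', hT', rfl⟩
  exact hT'.1.vertSet_eq ▸ cost_le hw T'

/-- The trees in a set `S` of children of the root cost no more than `centCost` summed over their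
vertex sets. -/
theorem IsCentroidTree.finsum_cost_le [Finite V] {G : SimpleGraph V} {w : V → ℝ}
    (hw : ∀ x, 0 ≤ w x) {s : Set V} {r : V} {ts : List (RTree V)}
    (h : IsCentroidTree G w s (RTree.node r ts)) {S : Set (RTree V)} (hS : ∀ t ∈ S, t ∈ ts) :
    ∑ᶠ t ∈ S, cost w t ≤ ∑ᶠ H ∈ RTree.vertSet '' S, centCost G w H := by
  have hinj : Set.InjOn RTree.vertSet S := fun a ha b hb hab =>
    h.1.eq_of_mem_children (hS a ha) (hS b hb) a.root_mem_vertSet (hab ▸ a.root_mem_vertSet)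
  rw [finsum_mem_image hinj]
  exact finsum_mem_le_finsum_mem (ts.finite_toSet.subset hS) fun t ht =>
    (h.child (hS t ht)).cost_le_centCost hw

theorem IsCentroidTree.cost_le_of_path [Finite V] {G : SimpleGraph V} {w : V → ℝ}
    (hw : ∀ x, 0 ≤ w x) (p : ℕ) : ∀ {s : Set V} {C : RTree V} {v : ℕ → V},
      IsCentroidTree G w s C → v 0 = C.root → (∀ i < p, ChildRel C (v i) (v (i + 1))) →
      cost w C ≤ (2 - 1 / 2 ^ p) * wsum w s +
        ∑ᶠ H ∈ comps G (s \ (v '' {i | i ≤ p})), centCost G w H := by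
  induction p with
  | zero =>
    rintro s ⟨r, ts⟩ v hC hv0 -
    have himg : v '' {i | i ≤ 0} = {r} := by
      simpa [Set.image_singleton, RTree.root] using hv0
    rw [himg, hC.1.cost_eq]
    have h₁ := hC.finsum_cost_le hw (S := {t | t ∈ ts}) fun t ht => ht
    have h₂ : ∑ᶠ H ∈ RTree.vertSet '' {t | t ∈ ts}, centCost G w H ≤
        ∑ᶠ H ∈ comps G (s \ {r}), centCost G w H := by
      refine finsum_mem_le_of_subset ?_ (Set.toFinite _) (centCost_nonneg G hw)
      rintro _ ⟨t, ht, rfl⟩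
      exact hC.1.child_vertSet_mem_comps ht subset_rfl (hC.1.child_vertSet_subset ht)
    norm_num
    linarith
  | succ p ih =>
    rintro s ⟨r, ts⟩ v hC hv0 hpath
    change v 0 = r at hv0
    obtain ⟨t, ht, htv⟩ := hC.1.exists_child_of_childRel (hv0 ▸ hpath 0 p.succ_pos)
    have hmem : ∀ i ≤ p, v (i + 1) ∈ t.vertSet := by
      intro i
      induction i with
      | zero => exact fun _ => htv ▸ t.root_mem_vertSet
      | succ i ihi =>
        exact fun hi => (hC.1.childRel_child ht (ihi (by omega))
          (hpath (i + 1) (by omega))).mem_vertSet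
    have hrec := ih (v := fun i => v (i + 1)) (hC.child ht) htv.symm fun i hi =>
      hC.1.childRel_child ht (hmem i hi.le) (hpath (i + 1) (by omega))
    set P : Set V := (fun i => v (i + 1)) '' {i | i ≤ p}
    have hPt : P ⊆ t.vertSet := by
      rintro _ ⟨i, hi, rfl⟩
      exact hmem i hi
    have himg : s \ (v '' {i | i ≤ p + 1}) = (s \ {r}) \ P := by
      rw [Set.sdiff_sdiff]
      congr 1
      ext x
      constructor
      · rintro ⟨_ | i, hi, rfl⟩
        · exact Or.inl hv0
        · exact Or.inr ⟨i, Nat.le_of_succ_le_succ hi, rfl⟩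
      · rintro (rfl | ⟨i, hi, rfl⟩)
        · exact ⟨0, Nat.zero_le _, hv0⟩
        · exact ⟨i + 1, Nat.succ_le_succ hi, rfl⟩
    rw [himg, hC.1.cost_eq]
    have hsplit : ∑ᶠ t ∈ {t | t ∈ ts}, cost w t =
        cost w t + ∑ᶠ t' ∈ {t | t ∈ ts} \ {t}, cost w t' := by
      rw [← finsum_mem_inter_add_sdiff {t} ts.finite_toSet,
        Set.inter_singleton_of_mem (show t ∈ {t | t ∈ ts} from ht), finsum_mem_singleton]
    have hrest := hC.finsum_cost_le hw (S := {t | t ∈ ts} \ {t}) fun t' ht' => ht'.1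
    have hcomps : ∑ᶠ H ∈ comps G (t.vertSet \ P), centCost G w H +
        ∑ᶠ H ∈ RTree.vertSet '' ({t | t ∈ ts} \ {t}), centCost G w H ≤
        ∑ᶠ H ∈ comps G ((s \ {r}) \ P), centCost G w H := by
      rw [← finsum_mem_union _ (Set.toFinite _) (Set.toFinite _)]
      · refine finsum_mem_le_of_subset (Set.union_subset ?_ ?_) (Set.toFinite _)
          (centCost_nonneg G hw)
        · rintro _ ⟨x, hx, rfl⟩
          have hsub := hC.1.child_vertSet_subset ht
          refine ⟨x, ⟨hsub hx.1, hx.2⟩, ?_⟩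
          rw [compIn_eq_compIn_inter (B := (s \ {r}) \ P) Set.sdiff_subset
            (hC.1.child_vertSet ht ▸ hx.1), ← hC.1.child_vertSet ht, ← Set.inter_sdiff_assoc,
            Set.inter_eq_left.2 hsub]
        · rintro _ ⟨t', ⟨ht', hne⟩, rfl⟩
          refine hC.1.child_vertSet_mem_comps ht' Set.sdiff_subset fun x hx =>
            ⟨hC.1.child_vertSet_subset ht' hx, fun hxP => hne ?_⟩
          exact hC.1.eq_of_mem_children ht' ht hx (hPt hxP)
      · rw [Set.disjoint_left]
        rintro _ ⟨x, hx, rfl⟩ ⟨t', ⟨ht', hne⟩, heq⟩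
        exact hne (hC.1.eq_of_mem_children ht' ht (heq ▸ mem_compIn_self hx) hx.1)
    have hhalf := hC.wsum_child_le ht
    have hcoef : (0 : ℝ) ≤ 2 - 1 / 2 ^ p := by
      have : (1 : ℝ) / 2 ^ p ≤ 1 := by
        rw [div_le_one (by positivity)]
        exact one_le_pow₀ one_le_two
      linarith
    have hmul := mul_le_mul_of_nonneg_left hhalf hcoef
    have hgeom : (2 - 1 / 2 ^ (p + 1)) * wsum w s =
        wsum w s + (2 - 1 / 2 ^ p) * (wsum w s / 2) := by
      rw [pow_succ]
      field_simp
      ring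
    linarith

theorem centroid_tree_path_bound {V : Type} [Fintype V]
    (G : SimpleGraph V) (hG : G.IsTree) (w : V → ℝ) (hw : ∀ x, 0 ≤ w x)
    (C : RTree V) (hC : IsCentroidTree G w Set.univ C)
    (hmax : ∀ C' : RTree V, IsCentroidTree G w Set.univ C' → cost w C' ≤ cost w C)
    (p : ℕ) (v : ℕ → V) (hv0 : v 0 = C.root)
    (hpath : ∀ i < p, ChildRel C (v i) (v (i + 1))) :
    cost w C ≤ (2 - 1 / 2 ^ p) * wsum w Set.univ +
      ∑ᶠ H ∈ comps G (Set.univ \ (v '' {i | i ≤ p})), centCost G w H :=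
  hC.cost_le_of_path hw p hv0 hpath
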